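/- For n ≥ 1, let a_n be the number of configurations c : Fin n → ℤ that are monotone nondecreasing, satisfy c(0) = 0, and satisfy F(F(c)) = c (i.e., the number of period configurations of the unlabelled complete graph K_n up to adding a constant). Then a₁ = 1, a₂ = 2, a₃ = 6, a₄ = 19, and a_n = 5a_{n−1} − 7a_{n−2} + 4a_{n−3} for all n ≥ 5. -/

import Mathlib

/-- The parallel diffusion firing operator on the complete graph on `Fin n`:
`F(c)(v) = c(v) + #{u : c(u) > c(v)} - #{u : c(u) < c(v)}`. -/
def fireK {V : Type*} [Fintype V] [DecidableEq V] (c : V → ℤ) : V → ℤ :=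
  fun v =>
    c v + ((Finset.univ.filter fun u => c v < c u).card : ℤ)
        - ((Finset.univ.filter fun u => c u < c v).card : ℤ)

/-- A multiset of integers is gap bounded when any two consecutive distinct values `x < y` in it
satisfy `y - x < count x + count y`. -/
def GapBounded (M : Multiset ℤ) : Prop :=
  ∀ x ∈ M, ∀ y ∈ M, x < y → (∀ z ∈ M, z ≤ x ∨ y ≤ z) → y - x < M.count x + M.count y

section Firing

variable {V : Type*} [Fintype V]

/-- The number of vertices above `v` minus the number of vertices below `v`. -/
def firingFlow (c : V → ℤ) (v : V) : ℤ :=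
  ((Finset.univ.filter fun u => c v < c u).card : ℤ)
    - ((Finset.univ.filter fun u => c u < c v).card : ℤ)

theorem fireK_apply [DecidableEq V] (c : V → ℤ) (v : V) :
    fireK c v = c v + firingFlow c v := by
  simp only [fireK, firingFlow]; ring

theorem firingFlow_congr {c : V → ℤ} {u v : V} (h : c u = c v) :
    firingFlow c u = firingFlow c v := by
  simp only [firingFlow, h]

theorem firingFlow_lt {c : V → ℤ} {u v : V} (h : c u < c v) :
    firingFlow c v < firingFlow c u := by
  have h₁ : (Finset.univ.filter fun w => c v < c w).card
      < (Finset.univ.filter fun w => c u < c w).card := by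
    refine Finset.card_lt_card ((Finset.ssubset_iff_of_subset fun w => ?_).2 ⟨v, by simpa, by simp⟩)
    simpa using h.trans
  have h₂ : (Finset.univ.filter fun w => c w < c u).card
      ≤ (Finset.univ.filter fun w => c w < c v).card := by
    refine Finset.card_le_card fun w => ?_
    simpa using fun hw => hw.trans h
  simp only [firingFlow]
  omega

theorem firingFlow_le {c : V → ℤ} {u v : V} (h : c u ≤ c v) :
    firingFlow c v ≤ firingFlow c u := by
  rcases h.lt_or_eq with h | h
  · exact (firingFlow_lt h).le
  · exact (firingFlow_congr h).ge

theorem fireK_fireK_eq_iff [DecidableEq V] (c : V → ℤ) :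
    fireK (fireK c) = c ↔ ∀ u v, c u < c v → fireK c v < fireK c u := by
  constructor
  · intro h u v huv
    by_contra! hle
    have hu := congrFun h u
    have hv := congrFun h v
    rw [fireK_apply, fireK_apply] at hu hv
    have := firingFlow_lt huv
    have := firingFlow_le hle
    omega
  · intro h
    have key : ∀ u v, fireK c u < fireK c v ↔ c v < c u := by
      refine fun u v => ⟨fun huv => ?_, h v u⟩
      by_contra! hle
      rcases hle.lt_or_eq with hlt | heq
      · exact huv.not_gt (h u v hlt)
      · rw [fireK_apply, fireK_apply, heq, firingFlow_congr heq] at huv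
        exact huv.false
    funext v
    rw [fireK_apply, fireK_apply]
    simp only [firingFlow, key]
    ring

/-- For consecutive values the flow drops by the sizes of the two level sets. -/
theorem firingFlow_of_consecutive {c : V → ℤ} {u v : V} (huv : c u < c v)
    (hcons : ∀ w, c w ≤ c u ∨ c v ≤ c w) :
    firingFlow c u = firingFlow c v + (Finset.univ.filter fun w => c w = c u).card
      + (Finset.univ.filter fun w => c w = c v).card := by
  have h₁ : (Finset.univ.filter fun w => c u < c w).card
      = (Finset.univ.filter fun w => c v < c w).card
        + (Finset.univ.filter fun w => c w = c v).card := by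
    classical
    rw [← Finset.card_union_of_disjoint]
    · congr 1; ext w; have := hcons w; simp; omega
    · rw [Finset.disjoint_filter]; intro w; omega
  have h₂ : (Finset.univ.filter fun w => c w < c v).card
      = (Finset.univ.filter fun w => c w < c u).card
        + (Finset.univ.filter fun w => c w = c u).card := by
    classical
    rw [← Finset.card_union_of_disjoint]
    · congr 1; ext w; have := hcons w; simp; omega
    · rw [Finset.disjoint_filter]; intro w; omega
  simp only [firingFlow]
  omega

theorem count_map_univ (c : V → ℤ) (x : ℤ) :
    ((Finset.univ : Finset V).val.map c).count x
      = (Finset.univ.filter fun w => c w = x).card := by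
  rw [Multiset.count_map, Finset.card_def, Finset.filter_val]
  simp only [eq_comm]

theorem fireK_fireK_eq_iff_gapBounded [DecidableEq V] (c : V → ℤ) :
    fireK (fireK c) = c ↔ GapBounded ((Finset.univ : Finset V).val.map c) := by
  rw [fireK_fireK_eq_iff]
  simp only [GapBounded, Multiset.mem_map, Finset.mem_val, Finset.mem_univ, true_and,
    forall_exists_index, forall_apply_eq_imp_iff, count_map_univ, fireK_apply]
  constructor
  · intro h u v huv hcons
    have := h u v huv
    have := firingFlow_of_consecutive huv hcons
    omega
  · intro h u v huv
    obtain ⟨k, hk⟩ : ∃ k : ℕ, c v - c u ≤ k := ⟨(c v - c u).toNat, Int.self_le_toNat _⟩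
    induction k generalizing u v with
    | zero => omega
    | succ k ih =>
      by_cases hcons : ∀ w, c w ≤ c u ∨ c v ≤ c w
      · have := h u v huv hcons
        have := firingFlow_of_consecutive huv hcons
        omega
      · push Not at hcons
        obtain ⟨w, hw₁, hw₂⟩ := hcons
        exact (ih w v hw₂ (by omega)).trans (ih u w hw₁ (by omega))

end Firing

theorem GapBounded.replicate (s : ℕ) (a : ℤ) : GapBounded (Multiset.replicate s a) := by
  intro x hx y hy hxy
  rw [Multiset.eq_of_mem_replicate hx, Multiset.eq_of_mem_replicate hy] at hxy
  exact absurd hxy (lt_irrefl a)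

theorem gapBounded_replicate_add {s : ℕ} (hs : s ≠ 0) {a b : ℤ} (hab : a < b) {M : Multiset ℤ}
    (hb : b ∈ M) (hM : ∀ z ∈ M, b ≤ z) :
    GapBounded (Multiset.replicate s a + M) ↔ b - a < s + M.count b ∧ GapBounded M := by
  have ha : a ∉ M := fun h => (hM a h).not_gt hab
  have hne : ∀ z ∈ M, a ≠ z := fun z hz h => ha (h ▸ hz)
  have hcount : ∀ z ∈ M, (Multiset.replicate s a + M).count z = M.count z := by
    intro z hz
    rw [Multiset.count_add, Multiset.count_replicate, if_neg (hne z hz), zero_add]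
  have hcount_a : (Multiset.replicate s a + M).count a = s := by
    rw [Multiset.count_add, Multiset.count_replicate_self, Multiset.count_eq_zero.2 ha, add_zero]
  have hmem : ∀ z, z ∈ Multiset.replicate s a + M ↔ z = a ∨ z ∈ M := by
    intro z; rw [Multiset.mem_add, Multiset.mem_replicate]; simp [hs]
  constructor
  · intro h
    refine ⟨?_, fun x hx y hy hxy hcons => ?_⟩
    · have := h a ((hmem a).2 (.inl rfl)) b ((hmem b).2 (.inr hb)) hab fun z hz =>
        ((hmem z).1 hz).imp le_of_eq (hM z)
      rwa [hcount_a, hcount b hb] at this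
    · have := h x ((hmem x).2 (.inr hx)) y ((hmem y).2 (.inr hy)) hxy fun z hz => by
        rcases (hmem z).1 hz with rfl | hz
        · exact .inl (hab.le.trans (hM x hx))
        · exact hcons z hz
      rwa [hcount x hx, hcount y hy] at this
  · rintro ⟨hgap, h⟩ x hx y hy hxy hcons
    rcases (hmem y).1 hy with rfl | hyM
    · rcases (hmem x).1 hx with rfl | hxM
      · exact absurd hxy (lt_irrefl x)
      · exact absurd (hM x hxM) (by omega)
    rw [hcount y hyM]
    rcases (hmem x).1 hx with rfl | hxM
    · have hby : b = y := (hM y hyM).antisymm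
        ((hcons b ((hmem b).2 (.inr hb))).resolve_left (by omega))
      rwa [hcount_a, ← hby]
    · rw [hcount x hxM]
      exact h x hxM y hyM hxy fun z hz => hcons z ((hmem z).2 (.inr hz))

/-- The sorted lists of length `m` that continue a block of `s` copies of `a`, that prolong this
block by at least `e` further copies of `a`, and for which the whole configuration is gap bounded
(see `mem_continuations`). -/
def continuations : ℕ → ℤ → ℕ → ℕ → Finset (List ℤ)
  | 0, _, _, e => if e = 0 then {[]} else ∅
  | m + 1, a, s, e =>
    (continuations m a (s + 1) (e - 1)).image (a :: ·) ∪
      if e = 0 then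
        (Finset.range (s + m)).biUnion fun d =>
          (continuations m (a + (d + 1)) 1 (d + 1 - s)).image ((a + (d + 1)) :: ·)
      else ∅

theorem cons_mem_continuations {m : ℕ} {a b : ℤ} {s e : ℕ} {l : List ℤ} :
    b :: l ∈ continuations (m + 1) a s e ↔
      b = a ∧ l ∈ continuations m a (s + 1) (e - 1) ∨
        e = 0 ∧ ∃ d < s + m, b = a + (d + 1) ∧ l ∈ continuations m b 1 (d + 1 - s) := by
  rw [continuations, Finset.mem_union, Finset.mem_image]
  refine or_congr (by simp [and_comm, eq_comm]) ?_
  split_ifs with he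
  · simp only [he, true_and, Finset.mem_biUnion, Finset.mem_image, Finset.mem_range,
      List.cons.injEq]
    refine exists_congr fun d => and_congr_right fun _ => ⟨?_, ?_⟩
    · rintro ⟨_, hl, rfl, rfl⟩
      exact ⟨rfl, hl⟩
    · rintro ⟨rfl, hl⟩
      exact ⟨l, hl, rfl, rfl⟩
  · simp [he]

theorem mem_continuations {m : ℕ} {a : ℤ} {s e : ℕ} (hs : s ≠ 0) {l : List ℤ} :
    l ∈ continuations m a s e ↔ l.length = m ∧ (a :: l).Pairwise (· ≤ ·) ∧ e ≤ l.count a ∧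
      GapBounded (Multiset.replicate s a + l) := by
  induction m generalizing a s e l with
  | zero =>
    rw [List.length_eq_zero_iff]
    by_cases he : e = 0
    · simp only [continuations, he, if_true, Finset.mem_singleton]
      refine ⟨?_, And.left⟩
      rintro rfl
      simpa using GapBounded.replicate s a
    · simp only [continuations, he, if_false, Finset.notMem_empty, false_iff]
      rintro ⟨rfl, -, h, -⟩
      simp at h
      exact he h
  | succ m ih =>
    have hsame : ∀ l : List ℤ, Multiset.replicate s a + ((a :: l : List ℤ) : Multiset ℤ)
        = Multiset.replicate (s + 1) a + (l : Multiset ℤ) := by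
      intro l
      rw [← Multiset.cons_coe, Multiset.add_cons, Multiset.replicate_succ, Multiset.cons_add]
    rcases l with _ | ⟨b, l⟩
    · simp only [continuations]
      split_ifs <;> simp
    rcases lt_trichotomy b a with hba | rfl | hab
    · refine iff_of_false ?_ ?_
      · rw [cons_mem_continuations]
        rintro (⟨h, -⟩ | ⟨-, d, -, h, -⟩) <;> omega
      · rintro ⟨-, h, -⟩
        exact hba.not_ge (List.rel_of_pairwise_cons h (by simp))
    · have : b :: l ∈ continuations (m + 1) b s e ↔ l ∈ continuations m b (s + 1) (e - 1) := by
        rw [cons_mem_continuations]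
        refine ⟨?_, fun h => .inl ⟨rfl, h⟩⟩
        rintro (⟨-, h⟩ | ⟨-, d, -, h, -⟩)
        · exact h
        · omega
      rw [this, ih (Nat.succ_ne_zero s), hsame, List.length_cons, List.count_cons_self]
      simp only [add_left_inj, tsub_le_iff_right, List.pairwise_cons, List.mem_cons,
        forall_eq_or_imp, le_refl, true_and, and_self_left]
    · obtain ⟨d, rfl⟩ : ∃ d : ℕ, b = a + (d + 1) := ⟨(b - a - 1).toNat, by omega⟩
      have : (a + (d + 1)) :: l ∈ continuations (m + 1) a s e ↔
          e = 0 ∧ d < s + m ∧ l ∈ continuations m (a + (d + 1)) 1 (d + 1 - s) := by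
        rw [cons_mem_continuations]
        constructor
        · rintro (⟨h, -⟩ | ⟨he, k, hk, hkd, hl⟩)
          · omega
          · obtain rfl : d = k := by omega
            exact ⟨he, hk, hl⟩
        · rintro ⟨he, hd, hl⟩
          exact .inr ⟨he, d, hd, rfl, hl⟩
      rw [this, ih one_ne_zero, List.length_cons, add_left_inj]
      have hone : Multiset.replicate 1 (a + (d + 1 : ℤ)) + (l : Multiset ℤ)
          = (((a + (d + 1)) :: l : List ℤ) : Multiset ℤ) := by
        rw [Multiset.replicate_one, Multiset.singleton_add, Multiset.cons_coe]
      rw [hone]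
      have hsorted : (a :: (a + (d + 1 : ℤ)) :: l).Pairwise (· ≤ ·) ↔
          ((a + (d + 1 : ℤ)) :: l).Pairwise (· ≤ ·) := by
        rw [List.pairwise_cons]
        refine and_iff_right_of_imp fun h z hz => ?_
        rcases List.mem_cons.1 hz with rfl | hz
        · exact hab.le
        · exact hab.le.trans (List.rel_of_pairwise_cons h hz)
      rw [hsorted]
      by_cases hp : ((a + (d + 1 : ℤ)) :: l).Pairwise (· ≤ ·)
      · have hmin : ∀ z ∈ (((a + (d + 1)) :: l : List ℤ) : Multiset ℤ), a + (d + 1) ≤ z := by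
          intro z hz
          rcases List.mem_cons.1 (Multiset.mem_coe.1 hz) with rfl | hz
          · exact le_rfl
          · exact List.rel_of_pairwise_cons hp hz
        rw [gapBounded_replicate_add hs hab (by simp) hmin, Multiset.coe_count,
          List.count_cons_self, List.count_eq_zero.2 fun h => hab.not_ge (hmin a h)]
        have := List.count_le_length (a := a + (d + 1 : ℤ)) (l := l)
        constructor
        · rintro ⟨rfl, hd, hl, -, hc, hg⟩
          exact ⟨hl, hp, le_rfl, by push_cast; omega, hg⟩
        · rintro ⟨hl, -, he, hc, hg⟩
          push_cast at hc
          exact ⟨by omega, by omega, hl, hp, by omega, hg⟩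
      · simp [hp]

/-- The number of continuations by `m` elements of a block of size `s` is `slope * s + intercept`
for `(slope, intercept, _, _) = countState m`; the last two entries are the
partial sums occurring in the recursion for the first two. -/
def countState : ℕ → ℕ × ℕ × ℕ × ℕ
  | 0 => (0, 1, 0, 0)
  | m + 1 =>
    let (α, β, γ, σ) := countState m
    (2 * α + β, α + β + γ, γ + σ + 2 * α + β, σ + α)

theorem sum_slope (m : ℕ) :
    ∑ k ∈ Finset.range m, (countState (m - (k + 1))).1 = (countState m).2.2.2 := by
  induction m with
  | zero => rfl
  | succ m ih =>
    rw [Finset.sum_range_succ']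
    simp only [Nat.add_sub_add_right, ih, Nat.zero_add, Nat.add_sub_cancel]
    rfl

theorem sum_slope_mul_add_intercept (m : ℕ) :
    ∑ k ∈ Finset.range m,
      ((countState (m - (k + 1))).1 * (k + 2) + (countState (m - (k + 1))).2.1)
      = (countState m).2.2.1 := by
  induction m with
  | zero => rfl
  | succ m ih =>
    rw [Finset.sum_range_succ']
    have : ∀ k, (countState (m + 1 - (k + 1 + 1))).1 * (k + 1 + 2)
        + (countState (m + 1 - (k + 1 + 1))).2.1
        = ((countState (m - (k + 1))).1 * (k + 2) + (countState (m - (k + 1))).2.1)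
          + (countState (m - (k + 1))).1 := by
      intro k
      rw [Nat.add_sub_add_right]
      ring
    simp only [this, Finset.sum_add_distrib] at ih ⊢
    rw [sum_slope, ih]
    simp only [Nat.zero_add, Nat.add_sub_cancel, countState]
    ring

theorem card_continuations (m : ℕ) (a : ℤ) (s e : ℕ) :
    (continuations m a s e).card =
      if e ≤ m then (countState (m - e)).1 * (s + e) + (countState (m - e)).2.1 else 0 := by
  induction m generalizing a s e with
  | zero =>
    by_cases he : e = 0 <;> simp [continuations, he, countState]
  | succ m ih =>
    rw [continuations, Finset.card_union_of_disjoint,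
      Finset.card_image_of_injective _ (List.cons_injective), ih]
    · rcases e with _ | e
      · rw [if_pos rfl, Finset.card_biUnion]
        · simp only [Finset.card_image_of_injective _ (List.cons_injective), ih]
          rw [Finset.sum_range_add]
          have h₁ : ∀ d ∈ Finset.range s, (if d + 1 - s ≤ m then
              (countState (m - (d + 1 - s))).1 * (1 + (d + 1 - s))
                + (countState (m - (d + 1 - s))).2.1 else 0)
              = (countState m).1 + (countState m).2.1 := by
            intro d hd
            rw [Nat.sub_eq_zero_of_le (Finset.mem_range.1 hd)]
            simp
          have h₂ : ∀ k ∈ Finset.range m, (if s + k + 1 - s ≤ m then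
              (countState (m - (s + k + 1 - s))).1 * (1 + (s + k + 1 - s))
                + (countState (m - (s + k + 1 - s))).2.1 else 0)
              = (countState (m - (k + 1))).1 * (k + 2) + (countState (m - (k + 1))).2.1 := by
            intro k hk
            rw [add_assoc s, Nat.add_sub_cancel_left, if_pos (Nat.succ_le_of_lt (Finset.mem_range.1 hk))]
            ring
          rw [Finset.sum_congr rfl h₁, Finset.sum_congr rfl h₂, sum_slope_mul_add_intercept]
          simp [countState]
          ring
        · intro i _ j _ hij
          rw [Function.onFun, Finset.disjoint_left]
          simp only [Finset.mem_image, not_exists, not_and]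
          rintro _ ⟨l, -, rfl⟩ l' - h
          have := (List.cons.inj h).1
          omega
      · simp [add_assoc, add_comm 1 e]
    · rw [Finset.disjoint_left]
      rintro _ hl
      obtain ⟨l, -, rfl⟩ := Finset.mem_image.1 hl
      split_ifs
      · simp
        intros; omega
      · simp

theorem ncard_period_config (m : ℕ) :
    Set.ncard {c : Fin (m + 1) → ℤ | Monotone c ∧ c 0 = 0 ∧ fireK (fireK c) = c}
      = (continuations m 0 1 0).card := by
  have key : ∀ c : Fin (m + 1) → ℤ, c 0 = 0 →
      (Monotone c ∧ fireK (fireK c) = c ↔ List.ofFn (Fin.tail c) ∈ continuations m 0 1 0) := by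
    intro c hc
    have hcons : 0 :: List.ofFn (Fin.tail c) = List.ofFn c := by
      rw [List.ofFn_succ, hc]; rfl
    have hM : Multiset.replicate 1 0 + (List.ofFn (Fin.tail c) : Multiset ℤ)
        = Finset.univ.val.map c := by
      rw [Multiset.replicate_one, Multiset.singleton_add, Multiset.cons_coe, hcons,
        Fin.univ_val_map]
    rw [mem_continuations one_ne_zero, hM, hcons, fireK_fireK_eq_iff_gapBounded,
      List.pairwise_ofFn, monotone_iff_forall_lt]
    simp
  rw [← Set.ncard_coe_finset]
  refine Set.ncard_congr (fun c _ => List.ofFn (Fin.tail c)) ?_ ?_ ?_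
  · rintro c ⟨hmono, h0, hp⟩
    exact (key c h0).1 ⟨hmono, hp⟩
  · rintro c c' ⟨-, h0, -⟩ ⟨-, h0', -⟩ h
    rw [← Fin.cons_self_tail c, ← Fin.cons_self_tail c', List.ofFn_injective h, h0, h0']
  · intro l hl
    obtain rfl := ((mem_continuations one_ne_zero).1 hl).1
    have htail : List.ofFn (Fin.tail (Fin.cons 0 l.get : Fin (l.length + 1) → ℤ)) = l := by
      rw [Fin.tail_cons, List.ofFn_get]
    have := (key (Fin.cons 0 l.get) rfl).2 (by rwa [htail])
    exact ⟨Fin.cons 0 l.get, ⟨this.1, rfl, this.2⟩, htail⟩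

/-- If `a n` denotes the number of monotone nondecreasing configurations
`c : Fin n → ℤ` with `c 0 = 0` and `F(F(c)) = c` (i.e. the number of period
configurations of the unlabelled `K_n` up to adding a constant), then
`a 1 = 1`, `a 2 = 2`, `a 3 = 6`, `a 4 = 19`, and
`a n = 5 a (n-1) - 7 a (n-2) + 4 a (n-3)` for all `n ≥ 5`. -/
theorem period_config_count_recurrence (a : ℕ → ℕ)
    (ha : ∀ (n : ℕ) (hn : 1 ≤ n),
      a n = Set.ncard
        {c : Fin n → ℤ | Monotone c ∧ c ⟨0, hn⟩ = 0 ∧ fireK (fireK c) = c}) :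
    a 1 = 1 ∧ a 2 = 2 ∧ a 3 = 6 ∧ a 4 = 19 ∧
      ∀ n : ℕ, 5 ≤ n →
        (a n : ℤ) = 5 * a (n - 1) - 7 * a (n - 2) + 4 * a (n - 3) := by
  have hcount : ∀ m, a (m + 1) = (countState m).1 + (countState m).2.1 := by
    intro m
    rw [ha (m + 1) (Nat.succ_pos m)]
    refine (ncard_period_config m).trans ?_
    simp [card_continuations]
  refine ⟨hcount 0, hcount 1, hcount 2, hcount 3, fun n hn => ?_⟩
  obtain ⟨m, rfl⟩ := Nat.exists_eq_add_of_le' hn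
  have h₁ : m + 5 - 1 = m + 3 + 1 := rfl
  have h₂ : m + 5 - 2 = m + 2 + 1 := rfl
  have h₃ : m + 5 - 3 = m + 1 + 1 := rfl
  rw [h₁, h₂, h₃, hcount (m + 4), hcount (m + 3), hcount (m + 2), hcount (m + 1)]
  simp only [countState]
  push_cast
  ring
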